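/- There exists a universal constant c > 0 with the following property. Let K ≥ 2 and let T be sufficiently large relative to K (so that the construction's bias parameter is at most 1). Consider the bandit variable-noise model with the noise distribution D' under which at each round a single value ε_t ~ U(0,1) is drawn and ε_{i,t} = ε_t for every action i. Then for every bandit learning algorithm (which observes the realized noise parameters before acting and observes only the noisy feedback of the played action), there exists a strategy for assigning binary losses (possibly depending on the realized noise parameters) such that the expected regret satisfies Regret(T) ≥ c·T^{2/3}·K^{1/3}. -/

import Mathlib

open MeasureTheory

/-- Uniform measure on `[0,1]`. -/
noncomputable def uniform01 : Measure ℝ := volume.restrict (Set.Icc 0 1)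

/-- Real value of a Boolean loss. -/
def b2r (b : Bool) : ℝ := if b then 1 else 0

/-- A product of causal kernels, each of constant mass, sums to the product of the masses. -/
theorem sum_prod_causal {X : Type*} [Fintype X] [Nonempty X] :
    ∀ (n : ℕ) (κ : Fin n → (Fin n → X) → ℝ) (m : Fin n → ℝ),
      (∀ t h h', (∀ s, s ≤ t → h s = h' s) → κ t h = κ t h') →
      (∀ t h, ∑ x, κ t (Function.update h t x) = m t) →
      ∑ h, ∏ t, κ t h = ∏ t, m t := by
  intro n
  induction n with
  | zero => intro κ m _ _; simp
  | succ n ih =>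
    intro κ m hc hm
    obtain ⟨x₀⟩ := ‹Nonempty X›
    rw [← (Fin.snocEquiv (fun _ : Fin (n + 1) => X)).sum_comp, Fintype.sum_prod_type_right]
    have hsn : ∀ (x : X) (h : Fin n → X),
        (Fin.snocEquiv (fun _ : Fin (n + 1) => X)) (x, h) = Fin.snoc (α := fun _ => X) h x :=
      fun x h => rfl
    have h1 : ∀ (h : Fin n → X) (x : X) (t : Fin n),
        κ t.castSucc (Fin.snoc (α := fun _ => X) h x)
          = κ t.castSucc (Fin.snoc (α := fun _ => X) h x₀) := by
      intro h x t
      refine hc _ _ _ fun s hs => ?_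
      obtain ⟨s', rfl⟩ : ∃ s' : Fin n, s = s'.castSucc :=
        ⟨⟨s, by have := t.2; simp [Fin.le_def] at hs; omega⟩, rfl⟩
      simp
    have h2 : ∀ h : Fin n → X,
        ∑ x, κ (Fin.last n) (Fin.snoc (α := fun _ => X) h x) = m (Fin.last n) := by
      intro h
      rw [← hm (Fin.last n) (Fin.snoc (α := fun _ => X) h x₀)]
      exact Finset.sum_congr rfl fun x _ => by rw [Fin.update_snoc_last]
    simp only [hsn, Fin.prod_univ_castSucc, h1, ← Finset.mul_sum, h2]
    rw [← Finset.sum_mul, ih (fun t h => κ t.castSucc (Fin.snoc (α := fun _ => X) h x₀))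
      (fun t => m t.castSucc)]
    · intro t h h' hh
      refine hc _ _ _ fun s hs => ?_
      obtain ⟨s', rfl⟩ : ∃ s' : Fin n, s = s'.castSucc :=
        ⟨⟨s, by have := t.2; simp [Fin.le_def] at hs; omega⟩, rfl⟩
      simpa using hh s' (by simpa using hs)
    · intro t h
      rw [← hm t.castSucc (Fin.snoc (α := fun _ => X) h x₀)]
      simp [Fin.snoc_update]

/-- Probability that a loss `l` is observed as `b` when the flip probability is `p`. -/
def bitProb (l : Bool) (p : ℝ) (b : Bool) : ℝ := if Bool.xor l b then p else 1 - p

/-- Probability of the history `h` when the action probabilities are `a`, the noise parameters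
are `e` and the losses are `l`. -/
noncomputable def histProb {K T : ℕ} (a : Fin T → (Fin T → Fin K × Bool) → Fin K → ℝ)
    (e : Fin T → ℝ) (l : Fin K → Fin T → Bool) (h : Fin T → Fin K × Bool) : ℝ :=
  ∏ t, a t h (h t).1 * bitProb (l (h t).1 t) ((1 - e t) / 2) (h t).2

theorem histProb_nonneg {K T : ℕ} {a : Fin T → (Fin T → Fin K × Bool) → Fin K → ℝ}
    {e : Fin T → ℝ} (l : Fin K → Fin T → Bool) (ha : ∀ t h i, 0 ≤ a t h i)
    (he : ∀ t, e t ∈ Set.Icc (0 : ℝ) 1) (h : Fin T → Fin K × Bool) :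
    0 ≤ histProb a e l h := by
  refine Finset.prod_nonneg fun t _ => mul_nonneg (ha _ _ _) ?_
  have := he t
  unfold bitProb
  split_ifs <;> linarith [this.1, this.2]

theorem sum_histProb {K T : ℕ} [NeZero K] {a : Fin T → (Fin T → Fin K × Bool) → Fin K → ℝ}
    (e : Fin T → ℝ) (l : Fin K → Fin T → Bool)
    (hc : ∀ t h h', (∀ s : Fin T, s < t → h s = h' s) → a t h = a t h')
    (ha1 : ∀ t h, ∑ i, a t h i = 1) :
    ∑ h, histProb a e l h = 1 := by
  unfold histProb
  rw [sum_prod_causal T _ (fun _ => 1)]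
  · simp
  · intro t h h' hh
    rw [hc t h h' fun s hs => hh s hs.le, hh t le_rfl]
  · intro t h
    have hu : ∀ x, a t (Function.update h t x) = a t h := fun x =>
      hc _ _ _ fun s hs => Function.update_of_ne hs.ne _ _
    simp only [hu, Function.update_self, Fintype.sum_prod_type, Fintype.sum_bool]
    rw [← ha1 t h]
    refine Finset.sum_congr rfl fun i _ => ?_
    unfold bitProb
    cases l i t <;> simp <;> ring

/-- Sign of an observed bit. -/
def bitSign (b : Bool) : ℝ := if b then -1 else 1

/-- When every action has loss one in round `t`, the sign of the observation has conditional mean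
`-e t` given the action. -/
theorem sum_histProb_mul_bitSign {K T : ℕ} [NeZero K]
    {a : Fin T → (Fin T → Fin K × Bool) → Fin K → ℝ}
    (e : Fin T → ℝ) (l : Fin K → Fin T → Bool)
    (hc : ∀ t h h', (∀ s : Fin T, s < t → h s = h' s) → a t h = a t h')
    (ha1 : ∀ t h, ∑ i, a t h i = 1) (t : Fin T) (k : Fin K) (hl : l k t = true) :
    ∑ h, histProb a e l h * (if (h t).1 = k then bitSign (h t).2 + e t else 0) = 0 := by
  have key := sum_prod_causal T
    (fun s h => (a s h (h s).1 * bitProb (l (h s).1 s) ((1 - e s) / 2) (h s).2) *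
      (if s = t then (if (h s).1 = k then bitSign (h s).2 + e s else 0) else 1))
    (fun s => if s = t then 0 else 1) ?_ ?_
  · simp only [Finset.prod_mul_distrib, Finset.prod_ite_eq', Finset.mem_univ, if_true] at key
    simpa only [histProb, Finset.prod_mul_distrib] using key
  · intro t h h' hh
    rw [hc t h h' fun s hs => hh s hs.le, hh t le_rfl]
  · intro s h
    have hu : ∀ x, a s (Function.update h s x) = a s h := fun x =>
      hc _ _ _ fun s hs => Function.update_of_ne hs.ne _ _
    simp only [hu, Function.update_self, Fintype.sum_prod_type, Fintype.sum_bool]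
    by_cases hst : s = t
    · subst hst
      simp only [if_true]
      refine Finset.sum_eq_zero fun i _ => ?_
      by_cases hi : i = k
      · subst hi
        simp [bitProb, bitSign, hl]; ring
      · simp [hi]
    · simp only [hst, if_false, mul_one]
      rw [← ha1 s h]
      refine Finset.sum_congr rfl fun i _ => ?_
      unfold bitProb
      cases l i s <;> simp <;> ring

/-- Losses which are one in the rounds of noise parameter at most `δ`, except for the action `k`. -/
noncomputable def hiddenLoss {K T : ℕ} (δ : ℝ) (k : Fin K) (e : Fin T → ℝ) (i : Fin K)
    (t : Fin T) : Bool := decide (e t ≤ δ ∧ i ≠ k)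

/-- Losses which are one for all actions in the rounds of noise parameter at most `δ`. -/
noncomputable def uniformLoss {K T : ℕ} (δ : ℝ) (e : Fin T → ℝ) (_ : Fin K)
    (t : Fin T) : Bool := decide (e t ≤ δ)

/-- Half the logarithm of the likelihood ratio of two complementary bits. -/
noncomputable def halfLogRatio (x : ℝ) : ℝ := Real.log ((1 + x) / (1 - x)) / 2

/-- Half the log-likelihood ratio between `hiddenLoss` and `uniformLoss`. -/
noncomputable def logLik {K T : ℕ} (δ : ℝ) (k : Fin K) (e : Fin T → ℝ)
    (h : Fin T → Fin K × Bool) : ℝ :=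
  ∑ t, if e t ≤ δ then (if (h t).1 = k then bitSign (h t).2 * halfLogRatio (e t) else 0) else 0

/-- Number of plays of `k` in the rounds of noise parameter at most `δ`. -/
noncomputable def playCount {K T : ℕ} (δ : ℝ) (k : Fin K) (e : Fin T → ℝ)
    (h : Fin T → Fin K × Bool) : ℝ :=
  ∑ t, if e t ≤ δ then (if (h t).1 = k then 1 else 0) else 0

/-- Number of rounds of noise parameter at most `δ`. -/
noncomputable def lowCount {T : ℕ} (δ : ℝ) (e : Fin T → ℝ) : ℝ :=
  ∑ t, if e t ≤ δ then 1 else 0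

theorem histProb_hiddenLoss {K T : ℕ} {δ : ℝ} (hδ : δ ≤ 1 / 2)
    (a : Fin T → (Fin T → Fin K × Bool) → Fin K → ℝ) (k : Fin K) {e : Fin T → ℝ}
    (he : ∀ t, e t ∈ Set.Icc (0 : ℝ) 1) (h : Fin T → Fin K × Bool) :
    histProb a e (hiddenLoss δ k e) h
      = histProb a e (uniformLoss δ e) h * Real.exp (logLik δ k e h) ^ 2 := by
  unfold histProb logLik
  rw [← Real.exp_nat_mul, Finset.mul_sum, Real.exp_sum, ← Finset.prod_mul_distrib]
  refine Finset.prod_congr rfl fun t _ => ?_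
  rw [mul_assoc]
  congr 1
  by_cases hlow : e t ≤ δ
  · by_cases hk : (h t).1 = k
    · have h0 := (he t).1
      have hp : (0 : ℝ) < 1 - e t := by linarith
      have hp' : (0 : ℝ) < 1 + e t := by linarith
      have hexp : Real.exp (Real.log ((1 + e t) / (1 - e t))) = (1 + e t) / (1 - e t) :=
        Real.exp_log (by positivity)
      cases hb : (h t).2
      · have : (2 : ℕ) * (bitSign false * halfLogRatio (e t))
            = Real.log ((1 + e t) / (1 - e t)) := by
          simp [bitSign, halfLogRatio]; ring
        simp only [hlow, hk, if_true, this, hexp, bitProb, hiddenLoss, uniformLoss]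
        simp; field_simp; ring
      · have : (2 : ℕ) * (bitSign true * halfLogRatio (e t))
            = -Real.log ((1 + e t) / (1 - e t)) := by
          simp [bitSign, halfLogRatio]; ring
        simp only [hlow, hk, if_true, this, Real.exp_neg, hexp, bitProb, hiddenLoss, uniformLoss]
        simp; field_simp; ring
    · simp [hlow, hk, hiddenLoss, uniformLoss]
  · simp [hlow, hiddenLoss, uniformLoss]

theorem halfLogRatio_le {x : ℝ} (h0 : 0 ≤ x) (h1 : x ≤ 1 / 2) : halfLogRatio x ≤ 2 * x := by
  unfold halfLogRatio
  have hp : (0 : ℝ) < 1 - x := by linarith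
  have := Real.log_le_sub_one_of_pos (show 0 < (1 + x) / (1 - x) by positivity)
  have h2 : (1 + x) / (1 - x) - 1 ≤ 4 * x := by
    rw [sub_le_iff_le_add, div_le_iff₀ hp]; nlinarith
  linarith

theorem sum_histProb_mul_logLik {K T : ℕ} [NeZero K] {δ : ℝ} (hδ : δ ≤ 1 / 2)
    {a : Fin T → (Fin T → Fin K × Bool) → Fin K → ℝ} (k : Fin K) {e : Fin T → ℝ}
    (he : ∀ t, e t ∈ Set.Icc (0 : ℝ) 1)
    (hc : ∀ t h h', (∀ s : Fin T, s < t → h s = h' s) → a t h = a t h')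
    (ha : ∀ t h i, 0 ≤ a t h i) (ha1 : ∀ t h, ∑ i, a t h i = 1) :
    -(2 * δ ^ 2 * ∑ h, histProb a e (uniformLoss δ e) h * playCount δ k e h)
      ≤ ∑ h, histProb a e (uniformLoss δ e) h * logLik δ k e h := by
  set P := histProb a e (uniformLoss δ e) with hP
  have hP0 : ∀ h, 0 ≤ P h := histProb_nonneg _ ha he
  unfold playCount logLik
  simp only [Finset.mul_sum]
  rw [Finset.sum_comm, Finset.sum_comm (s := Finset.univ (α := Fin T → Fin K × Bool)),
    ← Finset.sum_neg_distrib]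
  refine Finset.sum_le_sum fun t _ => ?_
  by_cases hlow : e t ≤ δ
  · have h0 := (he t).1
    have hz := sum_histProb_mul_bitSign e (uniformLoss δ e) hc ha1 t k (by simpa [uniformLoss])
    rw [← hP] at hz
    have : ∑ h, P h * (if e t ≤ δ then
          (if (h t).1 = k then bitSign (h t).2 * halfLogRatio (e t) else 0) else 0)
        = - ∑ h, P h * (if (h t).1 = k then e t * halfLogRatio (e t) else 0) := by
      have hz' := congrArg (halfLogRatio (e t) * ·) hz
      simp only [mul_zero, Finset.mul_sum] at hz'
      rw [eq_neg_iff_add_eq_zero, ← Finset.sum_add_distrib]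
      refine Eq.trans ?_ hz'
      refine Finset.sum_congr rfl fun h _ => ?_
      simp only [hlow, if_true]
      split_ifs <;> ring
    rw [this, neg_le_neg_iff]
    refine Finset.sum_le_sum fun h _ => ?_
    simp only [hlow, if_true]
    split_ifs
    · have h1 := halfLogRatio_le h0 (hlow.trans hδ)
      have : e t * halfLogRatio (e t) ≤ 2 * δ ^ 2 := by nlinarith
      nlinarith [hP0 h]
    · simp
  · simp [hlow]

/-- Change of measure between the losses `hiddenLoss` and `uniformLoss`. -/
theorem sum_histProb_mul_playCount_le {K T : ℕ} [NeZero K] {δ : ℝ} (hδ : δ ≤ 1 / 2)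
    {a : Fin T → (Fin T → Fin K × Bool) → Fin K → ℝ} (k : Fin K) {e : Fin T → ℝ}
    (he : ∀ t, e t ∈ Set.Icc (0 : ℝ) 1)
    (hc : ∀ t h h', (∀ s : Fin T, s < t → h s = h' s) → a t h = a t h')
    (ha : ∀ t h i, 0 ≤ a t h i) (ha1 : ∀ t h, ∑ i, a t h i = 1) :
    ∑ h, histProb a e (hiddenLoss δ k e) h * playCount δ k e h
      ≤ (1 + 32 * δ ^ 2 * lowCount δ e) *
          ∑ h, histProb a e (uniformLoss δ e) h * playCount δ k e h + lowCount δ e / 8 := by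
  have hS := sum_histProb_mul_logLik hδ k he hc ha ha1
  have hP0 : ∀ h, 0 ≤ histProb a e (uniformLoss δ e) h := histProb_nonneg _ ha he
  have hP1 := sum_histProb e (uniformLoss δ e) hc ha1
  have hQ1 := sum_histProb e (hiddenLoss δ k e) hc ha1
  have hQ := histProb_hiddenLoss hδ a k he
  simp only [hQ] at hQ1 ⊢
  set P := histProb a e (uniformLoss δ e)
  set M := lowCount δ e with hM
  set G := fun h => Real.exp (logLik δ k e h) with hG
  have hN : ∀ h, playCount δ k e h ≤ M := fun h => by
    refine Finset.sum_le_sum fun t _ => ?_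
    split_ifs <;> simp
  have hN0 : ∀ h, 0 ≤ playCount δ k e h := fun h => by
    refine Finset.sum_nonneg fun t _ => ?_
    split_ifs <;> simp
  have hM0 : 0 ≤ M := by
    refine Finset.sum_nonneg fun t _ => ?_
    split_ifs <;> simp
  have hpt : ∀ h, P h * G h ^ 2 * playCount δ k e h
      ≤ P h * playCount δ k e h + M * (P h * (G h ^ 2 + 1) / 16 +
        8 * (P h * G h ^ 2 + P h - 2 * P h * (logLik δ k e h + 1))) := by
    intro h
    have hx : 0 ≤ (G h ^ 2 + 1) / 16 + 8 * (G h - 1) ^ 2 - (G h ^ 2 - 1) := by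
      nlinarith [sq_nonneg ((G h + 1) - 16 * (G h - 1)), sq_nonneg (G h - 1)]
    have hx' : 0 ≤ (G h ^ 2 + 1) / 16 + 8 * (G h - 1) ^ 2 := by positivity
    have hy : (G h ^ 2 - 1) * playCount δ k e h
        ≤ M * ((G h ^ 2 + 1) / 16 + 8 * (G h - 1) ^ 2) := by
      nlinarith [mul_nonneg hx (hN0 h), mul_nonneg hx' (sub_nonneg.2 (hN h))]
    have hz : logLik δ k e h + 1 ≤ G h := Real.add_one_le_exp _
    have := mul_le_mul_of_nonneg_left hy (hP0 h)
    have := mul_nonneg (mul_nonneg hM0 (hP0 h)) (sub_nonneg.2 hz)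
    nlinarith
  refine (Finset.sum_le_sum fun h _ => hpt h).trans ?_
  have hsum : ∑ h, (P h * playCount δ k e h + M * (P h * (G h ^ 2 + 1) / 16 +
        8 * (P h * G h ^ 2 + P h - 2 * P h * (logLik δ k e h + 1))))
      = ∑ h, P h * playCount δ k e h + M * ((∑ h, P h * G h ^ 2 + ∑ h, P h) / 16 +
        8 * (∑ h, P h * G h ^ 2 + ∑ h, P h - 2 * (∑ h, P h * logLik δ k e h + ∑ h, P h))) := by
    simp only [Finset.mul_sum, ← Finset.sum_add_distrib, Finset.sum_div, ← Finset.sum_sub_distrib]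
    refine Finset.sum_congr rfl fun h _ => ?_
    ring
  rw [hsum, hP1, hQ1]
  nlinarith [mul_le_mul_of_nonneg_left hS hM0]

/-- Expected total loss of the player given the noise parameters. -/
noncomputable def condLoss {K T : ℕ} (a : Fin T → (Fin T → Fin K × Bool) → Fin K → ℝ)
    (e : Fin T → ℝ) (l : Fin K → Fin T → Bool) : ℝ :=
  ∑ h, histProb a e l h * ∑ t, b2r (l (h t).1 t)

theorem le_sum_condLoss_hiddenLoss {K T : ℕ} (hK : 2 ≤ K) {δ : ℝ} (hδ : δ ≤ 1 / 2)
    {a : Fin T → (Fin T → Fin K × Bool) → Fin K → ℝ} {e : Fin T → ℝ}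
    (he : ∀ t, e t ∈ Set.Icc (0 : ℝ) 1)
    (hc : ∀ t h h', (∀ s : Fin T, s < t → h s = h' s) → a t h = a t h')
    (ha : ∀ t h i, 0 ≤ a t h i) (ha1 : ∀ t h, ∑ i, a t h i = 1) :
    3 / 8 * K * lowCount δ e - 32 * δ ^ 2 * lowCount δ e ^ 2
      ≤ ∑ k, condLoss a e (hiddenLoss δ k e) := by
  have : NeZero K := ⟨by omega⟩
  have hM0 : 0 ≤ lowCount δ e := by
    refine Finset.sum_nonneg fun t _ => ?_
    split_ifs <;> simp
  have hcond : ∀ k, condLoss a e (hiddenLoss δ k e)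
      = lowCount δ e - ∑ h, histProb a e (hiddenLoss δ k e) h * playCount δ k e h := by
    intro k
    rw [← one_mul (lowCount δ e), ← sum_histProb e (hiddenLoss δ k e) hc ha1, Finset.sum_mul,
      ← Finset.sum_sub_distrib]
    refine Finset.sum_congr rfl fun h _ => ?_
    rw [← mul_sub]
    congr 1
    unfold lowCount playCount
    rw [← Finset.sum_sub_distrib]
    refine Finset.sum_congr rfl fun t _ => ?_
    by_cases h1 : e t ≤ δ <;> by_cases h2 : (h t).1 = k <;> simp [hiddenLoss, b2r, h1, h2]
  have htot : ∑ k, ∑ h, histProb a e (uniformLoss δ e) h * playCount δ k e h = lowCount δ e := by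
    rw [Finset.sum_comm, ← one_mul (lowCount δ e), ← sum_histProb e (uniformLoss δ e) hc ha1,
      Finset.sum_mul]
    refine Finset.sum_congr rfl fun h _ => ?_
    rw [← Finset.mul_sum]
    congr 1
    unfold lowCount playCount
    rw [Finset.sum_comm]
    refine Finset.sum_congr rfl fun t _ => ?_
    by_cases h1 : e t ≤ δ <;> simp [h1]
  have hle := Finset.sum_le_sum fun k (_ : k ∈ Finset.univ) =>
    sum_histProb_mul_playCount_le hδ k he hc ha ha1
  rw [Finset.sum_add_distrib, ← Finset.mul_sum, htot] at hle
  simp only [hcond, Finset.sum_sub_distrib]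
  simp only [Finset.sum_const, Finset.card_univ, Fintype.card_fin, nsmul_eq_mul] at hle ⊢
  have hK' : (2 : ℝ) ≤ K := by exact_mod_cast hK
  nlinarith [mul_le_mul_of_nonneg_right hK' hM0]

instance : IsProbabilityMeasure uniform01 := ⟨by simp [uniform01]⟩

/-- Law of the noise parameters of `T` rounds, and of each of the two families of seeds. -/
noncomputable abbrev noiseLaw (T : ℕ) : Measure (Fin T → ℝ) := Measure.pi fun _ => uniform01

theorem uniform01_real_Ico {x y : ℝ} (hx : 0 ≤ x) (hxy : x ≤ y) (hy : y ≤ 1) :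
    uniform01.real (Set.Ico x y) = y - x := by
  have : Set.Ico x y ∩ Set.Icc 0 1 = Set.Ico x y :=
    Set.inter_eq_left.2 fun z hz => ⟨hx.trans hz.1, hz.2.le.trans hy⟩
  rw [uniform01, measureReal_restrict_apply measurableSet_Ico, this, Real.volume_real_Ico,
    max_eq_left (by linarith)]

theorem uniform01_real_Iio {p : ℝ} (h0 : 0 ≤ p) (h1 : p ≤ 1) :
    uniform01.real (Set.Iio p) = p := by
  have : Set.Iio p ∩ Set.Icc 0 1 = Set.Ico 0 p := by
    ext z
    exact ⟨fun h => ⟨h.2.1, h.1⟩, fun h => ⟨h.2, h.1, h.2.le.trans h1⟩⟩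
  rw [uniform01, measureReal_restrict_apply measurableSet_Iio, this, Real.volume_real_Ico]
  simp [h0]

theorem uniform01_real_Iic {p : ℝ} (h0 : 0 ≤ p) (h1 : p ≤ 1) :
    uniform01.real (Set.Iic p) = p := by
  have : Set.Iic p ∩ Set.Icc 0 1 = Set.Icc 0 p := by
    ext z
    exact ⟨fun h => ⟨h.2.1, h.1⟩, fun h => ⟨h.2, h.1, h.2.trans h1⟩⟩
  rw [uniform01, measureReal_restrict_apply measurableSet_Iic, this, Real.volume_real_Icc]
  simp [h0]

theorem uniform01_real_xor {p : ℝ} (h0 : 0 ≤ p) (h1 : p ≤ 1) (l b : Bool) :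
    uniform01.real {r | Bool.xor l (decide (r < p)) = b} = bitProb l p b := by
  have hlt : uniform01.real {r | r < p} = p := uniform01_real_Iio h0 h1
  have hge : uniform01.real {r | p ≤ r} = 1 - p := by
    rw [show {r | p ≤ r} = (Set.Iio p)ᶜ by ext; simp, probReal_compl_eq_one_sub measurableSet_Iio,
      uniform01_real_Iio h0 h1]
  cases l <;> cases b <;> simp [bitProb, hlt, hge]

theorem measureReal_pi_pi {ι : Type*} [Fintype ι] {α : ι → Type*} [∀ i, MeasurableSpace (α i)]
    (μ : ∀ i, Measure (α i)) [∀ i, SigmaFinite (μ i)] (s : ∀ i, Set (α i)) :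
    (Measure.pi μ).real (Set.univ.pi s) = ∏ i, (μ i).real (s i) := by
  simp [Measure.real, Measure.pi_pi, ENNReal.toReal_prod]

theorem ae_noiseLaw {T : ℕ} {p : ℝ → Prop} (hp : ∀ᵐ x ∂uniform01, p x) :
    ∀ᵐ e ∂noiseLaw T, ∀ t, p (e t) := by
  rw [ae_all_iff]
  exact fun t => (measurePreserving_eval (fun _ : Fin T => uniform01) t).quasiMeasurePreserving.ae hp

theorem ae_uniform01_mem_Icc : ∀ᵐ x ∂uniform01, x ∈ Set.Icc (0 : ℝ) 1 :=
  ae_restrict_mem measurableSet_Icc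

theorem ae_uniform01_mem_Ico : ∀ᵐ x ∂uniform01, x ∈ Set.Ico (0 : ℝ) 1 := by
  have : ∀ᵐ x ∂uniform01, x ≠ 1 := ae_restrict_of_ae (Measure.ae_ne volume 1)
  filter_upwards [this, ae_uniform01_mem_Icc] with x hx hx'
  exact ⟨hx'.1, lt_of_le_of_ne hx'.2 hx⟩

/-- Law of noise parameters, action seeds and feedback seeds. -/
noncomputable abbrev seedLaw (T : ℕ) : Measure ((Fin T → ℝ) × (Fin T → ℝ) × (Fin T → ℝ)) :=
  (noiseLaw T).prod ((noiseLaw T).prod (noiseLaw T))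

/-- Action seeds which select the action `i` under the probabilities `v`. -/
def selSet {K : ℕ} (v : Fin K → ℝ) (i : Fin K) : Set ℝ :=
  Set.Ico (∑ j ∈ Finset.univ.filter (fun j => j < i), v j)
    (∑ j ∈ Finset.univ.filter (fun j => j ≤ i), v j)

theorem uniform01_real_selSet {K : ℕ} {v : Fin K → ℝ} (hv : ∀ j, 0 ≤ v j) (hv1 : ∑ j, v j = 1)
    (i : Fin K) : uniform01.real (selSet v i) = v i := by
  have hf : Finset.univ.filter (fun j => j ≤ i)
      = insert i (Finset.univ.filter (fun j => j < i)) := by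
    ext j; simp [le_iff_eq_or_lt]
  have hs : ∑ j ∈ Finset.univ.filter (fun j => j ≤ i), v j
      = v i + ∑ j ∈ Finset.univ.filter (fun j => j < i), v j := by
    rw [hf, Finset.sum_insert (by simp)]
  have h0 : 0 ≤ ∑ j ∈ Finset.univ.filter (fun j => j < i), v j :=
    Finset.sum_nonneg fun j _ => hv j
  have h1 : ∑ j ∈ Finset.univ.filter (fun j => j ≤ i), v j ≤ 1 :=
    hv1 ▸ Finset.sum_le_sum_of_subset_of_nonneg (Finset.filter_subset _ _) fun j _ _ => hv j
  rw [selSet, uniform01_real_Ico h0 (by linarith [hv i]) h1]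
  linarith

/-- Seeds which produce the history `h`. -/
def histEvent {K T : ℕ} (alg : Fin T → (Fin T → ℝ) → (Fin T → Fin K × Bool) → Fin K → ℝ)
    (ℓ : (Fin T → ℝ) → Fin K → Fin T → Bool) (h : Fin T → Fin K × Bool) :
    Set ((Fin T → ℝ) × (Fin T → ℝ) × (Fin T → ℝ)) :=
  {ω | ∀ t, ω.2.1 t ∈ selSet (alg t ω.1 h) (h t).1 ∧
    Bool.xor (ℓ ω.1 (h t).1 t) (decide (ω.2.2 t < (1 - ω.1 t) / 2)) = (h t).2}

section

variable {K T : ℕ} {alg : Fin T → (Fin T → ℝ) → (Fin T → Fin K × Bool) → Fin K → ℝ}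
  {ℓ : (Fin T → ℝ) → Fin K → Fin T → Bool}

theorem measurableSet_histEvent (hm : ∀ t h i, Measurable fun e => alg t e h i)
    (hℓ : ∀ k t, Measurable fun e => ℓ e k t) (h : Fin T → Fin K × Bool) :
    MeasurableSet (histEvent alg ℓ h) := by
  have hsum : ∀ t (s : Finset (Fin K)),
      Measurable fun ω : (Fin T → ℝ) × (Fin T → ℝ) × (Fin T → ℝ) => ∑ j ∈ s, alg t ω.1 h j :=
    fun t s => Finset.measurable_sum _ fun j _ => (hm t h j).comp measurable_fst
  have hu : ∀ t, Measurable fun ω : (Fin T → ℝ) × (Fin T → ℝ) × (Fin T → ℝ) => ω.2.1 t :=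
    fun t => by fun_prop
  have hd : ∀ t, Measurable fun ω : (Fin T → ℝ) × (Fin T → ℝ) × (Fin T → ℝ) =>
      decide (ω.2.2 t < (1 - ω.1 t) / 2) := fun t => by
    refine measurable_to_bool ?_
    have : MeasurableSet {ω : (Fin T → ℝ) × (Fin T → ℝ) × (Fin T → ℝ) |
      ω.2.2 t < (1 - ω.1 t) / 2} := measurableSet_lt (by fun_prop) (by fun_prop)
    convert this using 1
    ext ω; simp
  have hx : ∀ t, Measurable fun ω : (Fin T → ℝ) × (Fin T → ℝ) × (Fin T → ℝ) =>
      Bool.xor (ℓ ω.1 (h t).1 t) (decide (ω.2.2 t < (1 - ω.1 t) / 2)) := fun t =>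
    (measurable_of_finite fun p : Bool × Bool => Bool.xor p.1 p.2).comp
      (((hℓ (h t).1 t).comp measurable_fst).prodMk (hd t))
  unfold histEvent
  rw [Set.ofPred_forall]
  refine MeasurableSet.iInter fun t => ?_
  refine ((measurableSet_le (hsum t _) (hu t)).inter
    (measurableSet_lt (hu t) (hsum t _))).inter (hx t (measurableSet_singleton (h t).2))

theorem measureReal_histEvent_section {e : Fin T → ℝ} (he : ∀ t, e t ∈ Set.Icc (0 : ℝ) 1)
    (ha : ∀ t e h i, 0 ≤ alg t e h i) (ha1 : ∀ t e h, ∑ i, alg t e h i = 1)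
    (h : Fin T → Fin K × Bool) :
    ((noiseLaw T).prod (noiseLaw T)).real (Prod.mk e ⁻¹' histEvent alg ℓ h)
      = histProb (fun t => alg t e) e (ℓ e) h := by
  have : Prod.mk e ⁻¹' histEvent alg ℓ h =
      (Set.univ.pi fun t => selSet (alg t e h) (h t).1) ×ˢ
      (Set.univ.pi fun t =>
        {r | Bool.xor (ℓ e (h t).1 t) (decide (r < (1 - e t) / 2)) = (h t).2}) := by
    ext ⟨u, r⟩
    simp [histEvent, forall_and]
  rw [this, measureReal_prod_prod, measureReal_pi_pi, measureReal_pi_pi,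
    ← Finset.prod_mul_distrib, histProb]
  refine Finset.prod_congr rfl fun t _ => ?_
  rw [uniform01_real_selSet (ha t e h) (ha1 t e h), uniform01_real_xor] <;>
    linarith [(he t).1, (he t).2]

variable {sel : (Fin K → ℝ) → ℝ → Fin K}
  {hist : ((Fin T → ℝ) × (Fin T → ℝ) × (Fin T → ℝ)) → Fin T → Fin K × Bool}

theorem hist_eq_iff_mem_histEvent
    (hsel : ∀ (v : Fin K → ℝ) (u : ℝ) (i : Fin K), (∀ j, 0 ≤ v j) → 0 ≤ u → u < ∑ j, v j →
      (sel v u = i ↔ u ∈ selSet v i))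
    (hc : ∀ t e h h', (∀ s : Fin T, s < t → h s = h' s) → alg t e h = alg t e h')
    (ha : ∀ t e h i, 0 ≤ alg t e h i) (ha1 : ∀ t e h, ∑ i, alg t e h i = 1)
    (hI : ∀ ω t, (hist ω t).1 = sel (alg t ω.1 (hist ω)) (ω.2.1 t))
    (hB : ∀ ω t, (hist ω t).2 =
      Bool.xor (ℓ ω.1 (hist ω t).1 t) (decide (ω.2.2 t < (1 - ω.1 t) / 2)))
    {ω : (Fin T → ℝ) × (Fin T → ℝ) × (Fin T → ℝ)} (hω : ∀ t, ω.2.1 t ∈ Set.Ico (0 : ℝ) 1)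
    (h : Fin T → Fin K × Bool) :
    hist ω = h ↔ ω ∈ histEvent alg ℓ h := by
  have hsel' : ∀ t h i, sel (alg t ω.1 h) (ω.2.1 t) = i ↔ ω.2.1 t ∈ selSet (alg t ω.1 h) i :=
    fun t h i => hsel _ _ _ (ha _ _ _) (hω t).1 (by rw [ha1]; exact (hω t).2)
  constructor
  · rintro rfl t
    exact ⟨(hsel' _ _ _).1 (hI ω t).symm, (hB ω t).symm⟩
  · intro hmem
    have : ∀ n : ℕ, ∀ t : Fin T, t.1 = n → hist ω t = h t := by
      intro n
      induction n using Nat.strong_induction_on with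
      | _ n ih =>
        intro t ht
        have hpre : alg t ω.1 (hist ω) = alg t ω.1 h :=
          hc _ _ _ _ fun s hs => ih s (by rw [← ht]; exact hs) s rfl
        have h1 : (hist ω t).1 = (h t).1 := by
          rw [hI, hpre]; exact (hsel' _ _ _).2 (hmem t).1
        exact Prod.ext h1 (by rw [hB, h1]; exact (hmem t).2)
    exact funext fun t => this _ t rfl

/-- Loss of the history `h`, on the event that it occurs. -/
noncomputable def histLoss (alg : Fin T → (Fin T → ℝ) → (Fin T → Fin K × Bool) → Fin K → ℝ)
    (ℓ : (Fin T → ℝ) → Fin K → Fin T → Bool) (h : Fin T → Fin K × Bool)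
    (ω : (Fin T → ℝ) × (Fin T → ℝ) × (Fin T → ℝ)) : ℝ :=
  (histEvent alg ℓ h).indicator 1 ω * ∑ t, b2r (ℓ ω.1 (h t).1 t)

theorem integrable_histLoss (hm : ∀ t h i, Measurable fun e => alg t e h i)
    (hℓ : ∀ k t, Measurable fun e => ℓ e k t) (h : Fin T → Fin K × Bool) :
    Integrable (histLoss alg ℓ h) (seedLaw T) := by
  refine Integrable.of_bound (Measurable.aestronglyMeasurable ?_) T (ae_of_all _ fun ω => ?_)
  · refine (measurable_one.indicator (measurableSet_histEvent hm hℓ h)).mul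
      (Finset.measurable_sum _ fun t _ => ?_)
    exact (measurable_of_finite b2r).comp ((hℓ _ t).comp measurable_fst)
  · have hb : ∀ b, 0 ≤ b2r b ∧ b2r b ≤ 1 := by intro b; cases b <;> simp [b2r]
    have h1 : ∑ t, b2r (ℓ ω.1 (h t).1 t) ≤ T := by
      simpa using Finset.sum_le_sum fun t (_ : t ∈ Finset.univ) => (hb (ℓ ω.1 (h t).1 t)).2
    have h0 : 0 ≤ ∑ t, b2r (ℓ ω.1 (h t).1 t) := Finset.sum_nonneg fun t _ => (hb _).1
    by_cases hω : ω ∈ histEvent alg ℓ h <;> simp [histLoss, hω, abs_of_nonneg h0, h1]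

theorem integral_histLoss_section_ae_eq
    (ha : ∀ t e h i, 0 ≤ alg t e h i) (ha1 : ∀ t e h, ∑ i, alg t e h i = 1)
    (hm : ∀ t h i, Measurable fun e => alg t e h i)
    (hℓ : ∀ k t, Measurable fun e => ℓ e k t) (h : Fin T → Fin K × Bool) :
    (fun e => ∫ y, histLoss alg ℓ h (e, y) ∂(noiseLaw T).prod (noiseLaw T)) =ᵐ[noiseLaw T]
      fun e => histProb (fun t => alg t e) e (ℓ e) h * ∑ t, b2r (ℓ e (h t).1 t) := by
  filter_upwards [ae_noiseLaw (T := T) ae_uniform01_mem_Icc] with e he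
  simp only [histLoss]
  rw [integral_mul_const, ← measureReal_histEvent_section he ha ha1 h]
  congr 1
  exact integral_indicator_one (measurable_prodMk_left (measurableSet_histEvent hm hℓ h))

theorem integrable_histProb_mul (ha : ∀ t e h i, 0 ≤ alg t e h i)
    (ha1 : ∀ t e h, ∑ i, alg t e h i = 1) (hm : ∀ t h i, Measurable fun e => alg t e h i)
    (hℓ : ∀ k t, Measurable fun e => ℓ e k t) (h : Fin T → Fin K × Bool) :
    Integrable (fun e => histProb (fun t => alg t e) e (ℓ e) h * ∑ t, b2r (ℓ e (h t).1 t))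
      (noiseLaw T) :=
  (integrable_histLoss hm hℓ h).integral_prod_left.congr
    (integral_histLoss_section_ae_eq ha ha1 hm hℓ h)

theorem integrable_condLoss (ha : ∀ t e h i, 0 ≤ alg t e h i)
    (ha1 : ∀ t e h, ∑ i, alg t e h i = 1) (hm : ∀ t h i, Measurable fun e => alg t e h i)
    (hℓ : ∀ k t, Measurable fun e => ℓ e k t) :
    Integrable (fun e => condLoss (fun t => alg t e) e (ℓ e)) (noiseLaw T) :=
  integrable_finsetSum _ fun h _ => integrable_histProb_mul ha ha1 hm hℓ h

/-- The expected loss of the player is the average of its conditional expectations given the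
noise parameters. -/
theorem integral_loss_eq_integral_condLoss
    (hsel : ∀ (v : Fin K → ℝ) (u : ℝ) (i : Fin K), (∀ j, 0 ≤ v j) → 0 ≤ u → u < ∑ j, v j →
      (sel v u = i ↔ u ∈ selSet v i))
    (hc : ∀ t e h h', (∀ s : Fin T, s < t → h s = h' s) → alg t e h = alg t e h')
    (ha : ∀ t e h i, 0 ≤ alg t e h i) (ha1 : ∀ t e h, ∑ i, alg t e h i = 1)
    (hm : ∀ t h i, Measurable fun e => alg t e h i)
    (hℓ : ∀ k t, Measurable fun e => ℓ e k t)
    (hI : ∀ ω t, (hist ω t).1 = sel (alg t ω.1 (hist ω)) (ω.2.1 t))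
    (hB : ∀ ω t, (hist ω t).2 =
      Bool.xor (ℓ ω.1 (hist ω t).1 t) (decide (ω.2.2 t < (1 - ω.1 t) / 2))) :
    ∫ ω, (∑ t, b2r (ℓ ω.1 (hist ω t).1 t)) ∂seedLaw T
      = ∫ e, condLoss (fun t => alg t e) e (ℓ e) ∂noiseLaw T := by
  have hae : ∀ᵐ ω ∂seedLaw T, ∀ t, ω.2.1 t ∈ Set.Ico (0 : ℝ) 1 :=
    Measure.quasiMeasurePreserving_snd.ae
      (Measure.quasiMeasurePreserving_fst.ae (ae_noiseLaw ae_uniform01_mem_Ico))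
  have hEq : (fun ω => ∑ t, b2r (ℓ ω.1 (hist ω t).1 t))
      =ᵐ[seedLaw T] fun ω => ∑ h, histLoss alg ℓ h ω := by
    filter_upwards [hae] with ω hω
    have hiff := hist_eq_iff_mem_histEvent hsel hc ha ha1 hI hB hω
    rw [Finset.sum_eq_single (hist ω)]
    · simp [histLoss, (hiff (hist ω)).1 rfl]
    · intro h _ hne
      have : ω ∉ histEvent alg ℓ h := fun hmem => hne ((hiff h).2 hmem).symm
      simp [histLoss, this]
    · simp
  unfold condLoss
  rw [integral_congr_ae hEq, integral_finsetSum _ fun h _ => integrable_histLoss hm hℓ h,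
    integral_finsetSum _ fun h _ => integrable_histProb_mul ha ha1 hm hℓ h]
  refine Finset.sum_congr rfl fun h _ => ?_
  rw [integral_prod _ (integrable_histLoss hm hℓ h)]
  exact integral_congr_ae (integral_histLoss_section_ae_eq ha ha1 hm hℓ h)

end

theorem integral_noiseLaw_low {T : ℕ} {δ : ℝ} (h0 : 0 ≤ δ) (h1 : δ ≤ 1) (t : Fin T) :
    ∫ e, (if e t ≤ δ then (1 : ℝ) else 0) ∂noiseLaw T = δ := by
  have hm : Measurable fun x : ℝ => if x ≤ δ then (1 : ℝ) else 0 :=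
    Measurable.ite measurableSet_Iic measurable_const measurable_const
  rw [integral_comp_eval (μ := fun _ : Fin T => uniform01)
    (f := fun x : ℝ => if x ≤ δ then (1 : ℝ) else 0) hm.aestronglyMeasurable,
    show (fun x : ℝ => if x ≤ δ then (1 : ℝ) else 0) = (Set.Iic δ).indicator 1 from rfl,
    integral_indicator_one measurableSet_Iic, uniform01_real_Iic h0 h1]

theorem integral_noiseLaw_low_mul_low {T : ℕ} {δ : ℝ} (h0 : 0 ≤ δ) (h1 : δ ≤ 1) {s t : Fin T}
    (hst : s ≠ t) :
    ∫ e, (if e s ≤ δ then (1 : ℝ) else 0) * (if e t ≤ δ then 1 else 0) ∂noiseLaw T = δ ^ 2 := by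
  have hset : MeasurableSet (Set.univ.pi fun i : Fin T =>
      if i = s ∨ i = t then Set.Iic δ else Set.univ) :=
    MeasurableSet.univ_pi fun i => by split_ifs <;> measurability
  have : (fun e : Fin T → ℝ => (if e s ≤ δ then (1 : ℝ) else 0) * (if e t ≤ δ then 1 else 0))
      = (Set.univ.pi fun i : Fin T =>
        if i = s ∨ i = t then Set.Iic δ else Set.univ).indicator 1 := by
    ext e
    have hiff : (e ∈ Set.univ.pi fun i : Fin T =>
        if i = s ∨ i = t then Set.Iic δ else Set.univ) ↔ e s ≤ δ ∧ e t ≤ δ := by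
      refine ⟨fun h => ⟨by simpa using h s trivial, by simpa using h t trivial⟩, ?_⟩
      rintro ⟨h2, h3⟩ i -
      by_cases hi : i = s
      · simp [hi, h2]
      · by_cases hi' : i = t
        · simp [hi', h3]
        · simp [hi, hi']
    by_cases h2 : e s ≤ δ <;> by_cases h3 : e t ≤ δ <;> simp [Set.indicator, hiff, h2, h3]
  rw [this, integral_indicator_one hset, measureReal_pi_pi,
    Finset.prod_eq_mul s t hst _ (by simp) (by simp)]
  · simp [uniform01_real_Iic h0 h1, sq]
  · rintro i - ⟨hi, hi'⟩
    simp [hi, hi']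

theorem low_mul_self {x δ : ℝ} :
    (if x ≤ δ then (1 : ℝ) else 0) * (if x ≤ δ then 1 else 0) = if x ≤ δ then 1 else 0 := by
  split_ifs <;> simp

theorem integrable_low_mul_low {T : ℕ} (δ : ℝ) (s t : Fin T) :
    Integrable (fun e => (if e s ≤ δ then (1 : ℝ) else 0) * (if e t ≤ δ then 1 else 0))
      (noiseLaw T) := by
  refine Integrable.of_bound (Measurable.aestronglyMeasurable ?_) 1 (ae_of_all _ fun e => ?_)
  · exact (Measurable.ite (measurableSet_le (measurable_pi_apply s) measurable_const)
      measurable_const measurable_const).mul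
      (Measurable.ite (measurableSet_le (measurable_pi_apply t) measurable_const)
      measurable_const measurable_const)
  · split_ifs <;> simp

theorem integrable_low {T : ℕ} (δ : ℝ) (t : Fin T) :
    Integrable (fun e => if e t ≤ δ then (1 : ℝ) else 0) (noiseLaw T) := by
  simpa only [low_mul_self] using integrable_low_mul_low δ t t

theorem integral_lowCount {T : ℕ} {δ : ℝ} (h0 : 0 ≤ δ) (h1 : δ ≤ 1) :
    ∫ e, lowCount δ e ∂noiseLaw T = T * δ := by
  unfold lowCount
  rw [integral_finsetSum _ fun t _ => integrable_low δ t]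
  simp [integral_noiseLaw_low h0 h1]

theorem lowCount_sq {T : ℕ} (δ : ℝ) (e : Fin T → ℝ) :
    lowCount δ e ^ 2 = ∑ s, ∑ t, (if e s ≤ δ then (1 : ℝ) else 0) * (if e t ≤ δ then 1 else 0) := by
  rw [sq, lowCount, Finset.sum_mul_sum]

theorem integrable_lowCount {T : ℕ} (δ : ℝ) : Integrable (lowCount δ) (noiseLaw T) :=
  integrable_finsetSum _ fun t _ => integrable_low δ t

theorem integrable_lowCount_sq {T : ℕ} (δ : ℝ) :
    Integrable (fun e => lowCount δ e ^ 2) (noiseLaw T) := by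
  simp only [lowCount_sq]
  exact integrable_finsetSum _ fun s _ => integrable_finsetSum _ fun t _ =>
    integrable_low_mul_low δ s t

theorem integral_lowCount_sq_le {T : ℕ} {δ : ℝ} (h0 : 0 ≤ δ) (h1 : δ ≤ 1) :
    ∫ e, lowCount δ e ^ 2 ∂noiseLaw T ≤ (T * δ) ^ 2 + T * δ := by
  simp only [lowCount_sq]
  rw [integral_finsetSum _ fun s _ => integrable_finsetSum _ fun t _ =>
    integrable_low_mul_low δ s t]
  have : ∀ s : Fin T, ∫ e, ∑ t, (if e s ≤ δ then (1 : ℝ) else 0) * (if e t ≤ δ then 1 else 0)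
      ∂noiseLaw T ≤ T * δ ^ 2 + δ := by
    intro s
    rw [integral_finsetSum _ fun t _ => integrable_low_mul_low δ s t]
    have : ∀ t : Fin T, ∫ e, (if e s ≤ δ then (1 : ℝ) else 0) * (if e t ≤ δ then 1 else 0)
        ∂noiseLaw T ≤ δ ^ 2 + if s = t then δ else 0 := by
      intro t
      by_cases hst : s = t
      · subst hst
        simp only [low_mul_self, integral_noiseLaw_low h0 h1, if_true]
        linarith [sq_nonneg δ]
      · rw [integral_noiseLaw_low_mul_low h0 h1 hst, if_neg hst, add_zero]
    refine (Finset.sum_le_sum fun t _ => this t).trans ?_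
    simp [Finset.sum_add_distrib]
  refine (Finset.sum_le_sum fun s _ => this s).trans ?_
  simp
  nlinarith

theorem measurable_hiddenLoss {K T : ℕ} (δ : ℝ) (k i : Fin K) (t : Fin T) :
    Measurable fun e => hiddenLoss δ k e i t := by
  refine measurable_to_bool ?_
  have h : MeasurableSet {e : Fin T → ℝ | e t ≤ δ ∧ i ≠ k} :=
    (measurableSet_le (measurable_pi_apply t) measurable_const).inter (MeasurableSet.const _)
  convert h using 1
  ext e; simp [hiddenLoss]

/-- lower bound for Bandit with Variable Noise under the common-noise
distribution `D'` (one `ε_t ~ U(0,1)` shared by all actions).  Sample space: `ω.1 t = ε_t`;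
`ω.2.1 t` is a uniform seed turned into the sampled action by `sel`; `ω.2.2 t` is a uniform
seed generating the Bernoulli((1-ε_t)/2) noise bit of the played action.  The algorithm
observes the realized noise of rounds `≤ t` and the (action, feedback) history of rounds
`< t`; the loss strategy may depend on the realized noise parameters. -/
theorem bandit_variable_noise_lower_bound :
    ∃ c : ℝ, 0 < c ∧
      ∀ (K : ℕ) (hK : 2 ≤ K), ∃ T₀ : ℕ, ∀ T : ℕ, T₀ ≤ T →
        ∀ sel : (Fin K → ℝ) → ℝ → Fin K,
          (∀ (v : Fin K → ℝ) (u : ℝ) (i : Fin K),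
            (∀ j, 0 ≤ v j) → 0 ≤ u → u < ∑ j, v j →
            (sel v u = i ↔
              (∑ j ∈ Finset.univ.filter (fun j => j < i), v j) ≤ u ∧
                u < ∑ j ∈ Finset.univ.filter (fun j => j ≤ i), v j)) →
        ∀ alg : Fin T → (Fin T → ℝ) → (Fin T → Fin K × Bool) → Fin K → ℝ,
          (∀ t e e' h h', (∀ s : Fin T, s ≤ t → e s = e' s) →
            (∀ s : Fin T, s < t → h s = h' s) → alg t e h = alg t e' h') →
          (∀ t e h i, 0 ≤ alg t e h i) →
          (∀ t e h, ∑ i, alg t e h i = 1) →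
          (∀ t h i, Measurable fun e => alg t e h i) →
          ∃ ℓ : (Fin T → ℝ) → Fin K → Fin T → Bool,
            (∀ k t, Measurable fun e => ℓ e k t) ∧
            ∀ (hist : ((Fin T → ℝ) × (Fin T → ℝ) × (Fin T → ℝ)) → Fin T → Fin K × Bool)
              (qv : ((Fin T → ℝ) × (Fin T → ℝ) × (Fin T → ℝ)) → Fin T → Fin K → ℝ)
              (I : ((Fin T → ℝ) × (Fin T → ℝ) × (Fin T → ℝ)) → Fin T → Fin K)
              (cB : ((Fin T → ℝ) × (Fin T → ℝ) × (Fin T → ℝ)) → Fin T → Bool),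
              (∀ ω t, hist ω t = (I ω t, cB ω t)) →
              (∀ ω t, qv ω t = alg t ω.1 (hist ω)) →
              (∀ ω t, I ω t = sel (qv ω t) (ω.2.1 t)) →
              (∀ ω t, cB ω t =
                Bool.xor (ℓ ω.1 (I ω t) t) (decide (ω.2.2 t < (1 - ω.1 t) / 2))) →
              c * (T : ℝ) ^ ((2 : ℝ) / 3) * (K : ℝ) ^ ((1 : ℝ) / 3) ≤
                (∫ ω : (Fin T → ℝ) × (Fin T → ℝ) × (Fin T → ℝ),
                    (∑ t, b2r (ℓ ω.1 (I ω t) t))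
                    ∂((Measure.pi fun _ : Fin T => uniform01).prod
                        ((Measure.pi fun _ : Fin T => uniform01).prod
                          (Measure.pi fun _ : Fin T => uniform01))))
                  - Finset.univ.inf' (Finset.univ_nonempty_iff.mpr ⟨⟨0, by omega⟩⟩)
                      (fun k =>
                        ∫ ω : (Fin T → ℝ) × (Fin T → ℝ) × (Fin T → ℝ),
                          (∑ t, b2r (ℓ ω.1 k t))
                          ∂((Measure.pi fun _ : Fin T => uniform01).prod
                              ((Measure.pi fun _ : Fin T => uniform01).prod
                                (Measure.pi fun _ : Fin T => uniform01)))) := by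
  refine ⟨1 / 32, by norm_num, fun K hK => ⟨K + 512, fun T hT sel hsel alg hcaus ha ha1 hm => ?_⟩⟩
  have hc : ∀ t e h h', (∀ s : Fin T, s < t → h s = h' s) → alg t e h = alg t e h' :=
    fun t e h h' hh => hcaus t e e h h' (fun _ _ => rfl) hh
  have hK0 : (2 : ℝ) ≤ K := by exact_mod_cast hK
  have hT0 : (K : ℝ) + 512 ≤ T := by exact_mod_cast hT
  set R : ℝ := (T : ℝ) ^ ((2 : ℝ) / 3) * (K : ℝ) ^ ((1 : ℝ) / 3) with hR
  have hR3 : R ^ 3 = T ^ 2 * K := by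
    rw [hR, mul_pow, ← Real.rpow_mul_natCast (by linarith), ← Real.rpow_mul_natCast (by linarith)]
    norm_num
  have hTpos : (0 : ℝ) < T := by linarith
  have hKpos : (0 : ℝ) < K := by linarith
  have hR0 : 0 < R := by rw [hR]; positivity
  have hR8 : 8 ≤ R := by
    refine le_of_pow_le_pow_left₀ (n := 3) (by norm_num) hR0.le ?_
    rw [hR3]; nlinarith
  have hRT : R ≤ T := by
    refine le_of_pow_le_pow_left₀ (n := 3) (by norm_num) (by linarith) ?_
    rw [hR3]; nlinarith [sq_nonneg (T : ℝ)]
  obtain ⟨δ, hδ⟩ : ∃ δ : ℝ, T * δ = R / 8 := ⟨R / 8 / T, by field_simp⟩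
  have hδ0 : 0 ≤ δ := by
    by_contra! h
    nlinarith
  have hδ1 : δ ≤ 1 / 8 := by
    by_contra! h
    nlinarith
  have hδK : δ ^ 2 * (T * δ) = K / 512 := by
    have : (T * δ) ^ 3 = T ^ 2 * (K / 512) := by rw [hδ, div_pow, hR3]; ring
    have h2 : (T : ℝ) ^ 2 * (δ ^ 2 * (T * δ)) = T ^ 2 * (K / 512) := by rw [← this]; ring
    exact mul_left_cancel₀ (by positivity) h2
  have hIm : ∀ k : Fin K, ∀ i t, Measurable fun e => hiddenLoss (T := T) δ k e i t :=
    fun k i t => measurable_hiddenLoss δ k i t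
  have hint : ∀ k : Fin K,
      Integrable (fun e => condLoss (fun t => alg t e) e (hiddenLoss δ k e)) (noiseLaw T) :=
    fun k => integrable_condLoss ha ha1 hm (hIm k)
  have hsum : ∑ k : Fin K, R / 32
      ≤ ∑ k : Fin K, ∫ e, condLoss (fun t => alg t e) e (hiddenLoss δ k e) ∂noiseLaw T := by
    rw [← integral_finsetSum _ fun k _ => hint k]
    have hle : ∫ e, (3 / 8 * K * lowCount δ e - 32 * δ ^ 2 * lowCount δ e ^ 2) ∂noiseLaw T
        ≤ ∫ e, ∑ k, condLoss (fun t => alg t e) e (hiddenLoss δ k e) ∂noiseLaw T := by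
      refine integral_mono_ae (((integrable_lowCount δ).const_mul _).sub
        ((integrable_lowCount_sq δ).const_mul _)) (integrable_finsetSum _ fun k _ => hint k) ?_
      filter_upwards [ae_noiseLaw (T := T) ae_uniform01_mem_Icc] with e he
      exact le_sum_condLoss_hiddenLoss hK (by linarith) he (fun t => hc t e) (fun t => ha t e)
        (fun t => ha1 t e)
    refine le_trans ?_ hle
    rw [integral_sub ((integrable_lowCount δ).const_mul _)
      ((integrable_lowCount_sq δ).const_mul _), integral_const_mul, integral_const_mul,
      integral_lowCount hδ0 (by linarith)]
    have hsq := integral_lowCount_sq_le (T := T) hδ0 (by linarith)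
    have h1 : (1 : ℝ) ≤ T * δ := by rw [hδ]; linarith
    have hsq' : ∫ e, lowCount δ e ^ 2 ∂noiseLaw T ≤ 2 * (T * δ) ^ 2 := by nlinarith
    have hfin : 32 * δ ^ 2 * ∫ e, lowCount δ e ^ 2 ∂noiseLaw T ≤ K / 8 * (T * δ) :=
      (mul_le_mul_of_nonneg_left hsq' (by positivity)).trans_eq (by
        rw [show 32 * δ ^ 2 * (2 * (T * δ) ^ 2) = 64 * (δ ^ 2 * (T * δ)) * (T * δ) by ring, hδK]
        ring)
    have : ∑ _k : Fin K, R / 32 = K * (R / 32) := by simp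
    rw [this]
    rw [hδ] at hfin ⊢
    linarith
  have : NeZero K := ⟨by omega⟩
  obtain ⟨k, -, hk⟩ := Finset.exists_le_of_sum_le Finset.univ_nonempty hsum
  refine ⟨hiddenLoss δ k, hIm k, fun hist qv I cB hhist hqv hI hcB => ?_⟩
  have hI1 : ∀ ω t, I ω t = (hist ω t).1 := fun ω t => by rw [hhist]
  have hB1 : ∀ ω t, cB ω t = (hist ω t).2 := fun ω t => by rw [hhist]
  have hloss := integral_loss_eq_integral_condLoss (sel := sel) (hist := hist) hsel hc ha ha1 hm
    (hIm k) (fun ω t => by rw [← hI1, hI, hqv]) (fun ω t => by rw [← hB1, hcB, hI1])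
  have hmin := Finset.inf'_le (s := Finset.univ) (fun k' : Fin K =>
    ∫ ω, (∑ t, b2r (hiddenLoss δ k ω.1 k' t)) ∂seedLaw T) (Finset.mem_univ k)
  have hbest : ∫ ω, (∑ t, b2r (hiddenLoss δ k ω.1 k t)) ∂seedLaw T = 0 := by
    simp [hiddenLoss, b2r]
  rw [hbest] at hmin
  simp only [hI1]
  rw [mul_assoc]
  refine le_trans ?_ (sub_le_sub hloss.ge hmin)
  linarith
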